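/- Let g be a metric in Brill form g = e^{−2U+2α}(dρ²+dz²) + ρ²e^{−2U}(dφ + A_ρ dρ + A_z dz)², with Killing field η = ∂_φ, quotient metric ĝ = e^{−2U+2α}(dρ²+dz²), Gaussian curvature K of ĝ, and scalar curvature R of g. Then the norm |η| = ρ e^{−U} satisfies Δ̂|η| = |η|(K − R/2) − (1/4)|η|³ e^{4(U−α)}(∂_z A_ρ − ∂_ρ A_z)², where Δ̂ is the Laplace–Beltrami operator of ĝ. -/

import Mathlib

/- STATEMENT 6 (Lemma 3.2 of the paper): for the Brill metric with Killing field
η = ∂_φ, quotient metric ĝ = e^{−2U+2α}(dρ²+dz²) with Gaussian curvature K and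
Laplacian Δ̂, and |η| = ρe^{−U}:
  Δ̂|η| = |η|(K − R/2) − (1/4)|η|³ e^{4(U−α)}(∂_z A_ρ − ∂_ρ A_z)².
Scalar curvature R of g is defined in coordinates via Christoffel symbols; the
Gaussian curvature of the conformally flat 2-metric e^{2λ}δ is −e^{−2λ}Δλ and
its Laplace–Beltrami operator is e^{−2λ}Δ. -/

noncomputable section
open Real

/-- Partial derivative of a function on ℝ³ (coordinates indexed by `Fin 3`). -/
def pd3 (i : Fin 3) (f : (Fin 3 → ℝ) → ℝ) (x : Fin 3 → ℝ) : ℝ :=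
  fderiv ℝ f x (Pi.single i 1)

/-- Christoffel symbols Γᵏᵢⱼ of a metric given by its coordinate matrix. -/
def christoffel (g : (Fin 3 → ℝ) → Matrix (Fin 3) (Fin 3) ℝ)
    (k i j : Fin 3) (x : Fin 3 → ℝ) : ℝ :=
  (1 / 2) * ∑ l, (g x)⁻¹ k l *
    (pd3 i (fun y => g y l j) x + pd3 j (fun y => g y l i) x - pd3 l (fun y => g y i j) x)

/-- Ricci curvature Rᵢⱼ in coordinates. -/
def ricci (g : (Fin 3 → ℝ) → Matrix (Fin 3) (Fin 3) ℝ)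
    (i j : Fin 3) (x : Fin 3 → ℝ) : ℝ :=
  (∑ k, pd3 k (christoffel g k i j) x) - (∑ k, pd3 j (christoffel g k i k) x)
  + ∑ k, ∑ l, (christoffel g k k l x * christoffel g l i j x
      - christoffel g k j l x * christoffel g l i k x)

/-- Scalar curvature R = gⁱʲ Rᵢⱼ in coordinates. -/
def scalarCurv (g : (Fin 3 → ℝ) → Matrix (Fin 3) (Fin 3) ℝ) (x : Fin 3 → ℝ) : ℝ :=
  ∑ i, ∑ j, (g x)⁻¹ i j * ricci g i j x

/-- Partial derivatives and flat Laplacians on the (ρ,z) half plane. -/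
def pr (f : ℝ × ℝ → ℝ) (p : ℝ × ℝ) : ℝ := fderiv ℝ f p (1, 0)
def pz (f : ℝ × ℝ → ℝ) (p : ℝ × ℝ) : ℝ := fderiv ℝ f p (0, 1)
def lapRZ (f : ℝ × ℝ → ℝ) (p : ℝ × ℝ) : ℝ := pr (pr f) p + pz (pz f) p

/-- The Brill metric
g = e^{−2U+2α}(dρ²+dz²) + ρ²e^{−2U}(dφ + A_ρ dρ + A_z dz)²
as a matrix in the coordinates (x 0, x 1, x 2) = (ρ, z, φ). -/
def brillMetric (U α Ar Az : ℝ × ℝ → ℝ) (x : Fin 3 → ℝ) : Matrix (Fin 3) (Fin 3) ℝ :=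
  let p : ℝ × ℝ := (x 0, x 1)
  let e2 : ℝ := exp (-2 * U p + 2 * α p)
  let f : ℝ := (x 0) ^ 2 * exp (-2 * U p)
  !![e2 + f * (Ar p) ^ 2, f * Ar p * Az p, f * Ar p;
     f * Ar p * Az p, e2 + f * (Az p) ^ 2, f * Az p;
     f * Ar p, f * Az p, f]

/-- Gaussian curvature of the conformally flat 2-metric e^{2λ}(dρ²+dz²). -/
def gaussConf (lam : ℝ × ℝ → ℝ) (p : ℝ × ℝ) : ℝ := -exp (-2 * lam p) * lapRZ lam p

/-- Laplace–Beltrami operator of e^{2λ}(dρ²+dz²). -/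
def lapConf (lam f : ℝ × ℝ → ℝ) (p : ℝ × ℝ) : ℝ := exp (-2 * lam p) * lapRZ f p

open Filter Topology

section PartialDerivatives

variable {f g : ℝ × ℝ → ℝ} {p : ℝ × ℝ}

theorem pr_add (hf : DifferentiableAt ℝ f p) (hg : DifferentiableAt ℝ g p) :
    pr (fun q => f q + g q) p = pr f p + pr g p := by
  simp [pr, fderiv_fun_add hf hg]

theorem pz_add (hf : DifferentiableAt ℝ f p) (hg : DifferentiableAt ℝ g p) :
    pz (fun q => f q + g q) p = pz f p + pz g p := by
  simp [pz, fderiv_fun_add hf hg]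

theorem pr_sub (hf : DifferentiableAt ℝ f p) (hg : DifferentiableAt ℝ g p) :
    pr (fun q => f q - g q) p = pr f p - pr g p := by
  simp [pr, fderiv_fun_sub hf hg]

theorem pz_sub (hf : DifferentiableAt ℝ f p) (hg : DifferentiableAt ℝ g p) :
    pz (fun q => f q - g q) p = pz f p - pz g p := by
  simp [pz, fderiv_fun_sub hf hg]

theorem pr_neg : pr (fun q => -f q) p = -pr f p := by
  simp [pr, fderiv_fun_neg]

theorem pz_neg : pz (fun q => -f q) p = -pz f p := by
  simp [pz, fderiv_fun_neg]

theorem pr_mul (hf : DifferentiableAt ℝ f p) (hg : DifferentiableAt ℝ g p) :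
    pr (fun q => f q * g q) p = f p * pr g p + g p * pr f p := by
  simp [pr, fderiv_fun_mul hf hg]

theorem pz_mul (hf : DifferentiableAt ℝ f p) (hg : DifferentiableAt ℝ g p) :
    pz (fun q => f q * g q) p = f p * pz g p + g p * pz f p := by
  simp [pz, fderiv_fun_mul hf hg]

theorem pr_exp (hf : DifferentiableAt ℝ f p) :
    pr (fun q => exp (f q)) p = exp (f p) * pr f p := by
  simp [pr, fderiv_exp hf]

theorem pz_exp (hf : DifferentiableAt ℝ f p) :
    pz (fun q => exp (f q)) p = exp (f p) * pz f p := by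
  simp [pz, fderiv_exp hf]

theorem pr_const (c : ℝ) : pr (fun _ => c) p = 0 := by
  simp [pr]

theorem pz_const (c : ℝ) : pz (fun _ => c) p = 0 := by
  simp [pz]

theorem pr_congr (h : f =ᶠ[𝓝 p] g) : pr f p = pr g p := by
  simp only [pr, h.fderiv_eq]

theorem pz_congr (h : f =ᶠ[𝓝 p] g) : pz f p = pz g p := by
  simp only [pz, h.fderiv_eq]

theorem lapRZ_congr (h : f =ᶠ[𝓝 p] g) : lapRZ f p = lapRZ g p := by
  unfold lapRZ
  congr 1
  · exact pr_congr (h.eventually_nhds.mono fun _ => pr_congr)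
  · exact pz_congr (h.eventually_nhds.mono fun _ => pz_congr)

theorem differentiableAt_pr (hf : ContDiffAt ℝ 2 f p) : DifferentiableAt ℝ (pr f) p := by
  have h : ContDiffAt ℝ 1 (fderiv ℝ f) p := hf.fderiv_right (by norm_num)
  exact (h.differentiableAt one_ne_zero).clm_apply (differentiableAt_const _)

theorem differentiableAt_pz (hf : ContDiffAt ℝ 2 f p) : DifferentiableAt ℝ (pz f) p := by
  have h : ContDiffAt ℝ 1 (fderiv ℝ f) p := hf.fderiv_right (by norm_num)
  exact (h.differentiableAt one_ne_zero).clm_apply (differentiableAt_const _)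

theorem lapRZ_exp {s : Set (ℝ × ℝ)} (hs : IsOpen s) (hf : ∀ q ∈ s, ContDiffAt ℝ 2 f q)
    (hp : p ∈ s) :
    lapRZ (fun q => exp (f q)) p = exp (f p) * (lapRZ f p + pr f p ^ 2 + pz f p ^ 2) := by
  have hd : ∀ q ∈ s, DifferentiableAt ℝ f q := fun q hq => (hf q hq).differentiableAt (by simp)
  have h0 := hd p hp
  have h1 : pr (fun q => exp (f q)) =ᶠ[𝓝 p] fun q => exp (f q) * pr f q :=
    mem_of_superset (hs.mem_nhds hp) fun q hq => pr_exp (hd q hq)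
  have h2 : pz (fun q => exp (f q)) =ᶠ[𝓝 p] fun q => exp (f q) * pz f q :=
    mem_of_superset (hs.mem_nhds hp) fun q hq => pz_exp (hd q hq)
  unfold lapRZ
  rw [pr_congr h1, pz_congr h2, pr_mul h0.exp (differentiableAt_pr (hf p hp)),
    pz_mul h0.exp (differentiableAt_pz (hf p hp)), pr_exp h0, pz_exp h0]
  ring

end PartialDerivatives

section CoordinateDerivatives

variable {f : ℝ × ℝ → ℝ} {x : Fin 3 → ℝ}

theorem fderiv_comp_orbit (hf : DifferentiableAt ℝ f (x 0, x 1)) (v : Fin 3 → ℝ) :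
    fderiv ℝ (fun y : Fin 3 → ℝ => f (y 0, y 1)) x v =
      fderiv ℝ f (x 0, x 1) (v 0, v 1) := by
  have h : HasFDerivAt (fun y : Fin 3 → ℝ => (y 0, y 1))
      ((ContinuousLinearMap.proj (R := ℝ) (φ := fun _ : Fin 3 => ℝ) 0).prod
        (ContinuousLinearMap.proj (R := ℝ) (φ := fun _ : Fin 3 => ℝ) 1)) x :=
    (hasFDerivAt_apply 0 x).prodMk (hasFDerivAt_apply 1 x)
  have h2 := HasFDerivAt.comp x hf.hasFDerivAt h
  have h3 : fderiv ℝ (fun y : Fin 3 → ℝ => f (y 0, y 1)) x = _ := h2.fderiv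
  rw [h3]
  simp

theorem pd3_zero_orbit (hf : DifferentiableAt ℝ f (x 0, x 1)) :
    pd3 0 (fun y => f (y 0, y 1)) x = pr f (x 0, x 1) := by
  simp [pd3, pr, fderiv_comp_orbit hf]

theorem pd3_one_orbit (hf : DifferentiableAt ℝ f (x 0, x 1)) :
    pd3 1 (fun y => f (y 0, y 1)) x = pz f (x 0, x 1) := by
  simp [pd3, pz, fderiv_comp_orbit hf]

theorem pd3_two_orbit (f : ℝ × ℝ → ℝ) (x : Fin 3 → ℝ) :
    pd3 2 (fun y => f (y 0, y 1)) x = 0 := by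
  by_cases hd : DifferentiableAt ℝ (fun y : Fin 3 → ℝ => f (y 0, y 1)) x
  · have h := hd.hasFDerivAt.hasLineDerivAt (Pi.single 2 1)
    have h2 : HasLineDerivAt ℝ (fun y : Fin 3 → ℝ => f (y 0, y 1)) 0 x (Pi.single 2 1) := by
      unfold HasLineDerivAt
      simpa using hasDerivAt_const (0 : ℝ) (f (x 0, x 1))
    exact h.unique h2
  · simp [pd3, fderiv_zero_of_not_differentiableAt hd]

theorem pd3_congr {u v : (Fin 3 → ℝ) → ℝ} (i : Fin 3) (h : u =ᶠ[𝓝 x] v) :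
    pd3 i u x = pd3 i v x := by
  simp only [pd3, h.fderiv_eq]

end CoordinateDerivatives

section Locality

variable {g g' : (Fin 3 → ℝ) → Matrix (Fin 3) (Fin 3) ℝ} {x : Fin 3 → ℝ}

theorem christoffel_congr (h : g =ᶠ[𝓝 x] g') (k i j : Fin 3) :
    christoffel g k i j x = christoffel g' k i j x := by
  have hc (i l j : Fin 3) : pd3 i (fun y => g y l j) x = pd3 i (fun y => g' y l j) x :=
    pd3_congr i (h.mono fun y hy => by simp only [hy])
  simp only [christoffel, hc, h.eq_of_nhds]

theorem ricci_congr (h : g =ᶠ[𝓝 x] g') (i j : Fin 3) : ricci g i j x = ricci g' i j x := by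
  have hc (l k i j : Fin 3) : pd3 l (christoffel g k i j) x = pd3 l (christoffel g' k i j) x :=
    pd3_congr l (h.eventually_nhds.mono fun y hy => christoffel_congr hy k i j)
  simp only [ricci, hc, christoffel_congr h]

theorem scalarCurv_congr (h : g =ᶠ[𝓝 x] g') : scalarCurv g x = scalarCurv g' x := by
  simp only [scalarCurv, ricci_congr h, h.eq_of_nhds]

end Locality

/-- The matrix of `e^{2L}(dρ² + dz²) + e^{2M}(dφ + a dρ + b dz)²` at a point of the orbit space. -/
def killingMetric (L M a b : ℝ × ℝ → ℝ) (p : ℝ × ℝ) : Matrix (Fin 3) (Fin 3) ℝ :=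
  !![exp (2 * L p) + exp (2 * M p) * (a p * a p), exp (2 * M p) * (a p * b p), exp (2 * M p) * a p;
     exp (2 * M p) * (a p * b p), exp (2 * L p) + exp (2 * M p) * (b p * b p), exp (2 * M p) * b p;
     exp (2 * M p) * a p, exp (2 * M p) * b p, exp (2 * M p)]

theorem killingMetric_inv (L M a b : ℝ × ℝ → ℝ) (p : ℝ × ℝ) :
    (killingMetric L M a b p)⁻¹ =
      !![(exp (2 * L p))⁻¹, 0, -(exp (2 * L p))⁻¹ * a p;
         0, (exp (2 * L p))⁻¹, -(exp (2 * L p))⁻¹ * b p;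
         -(exp (2 * L p))⁻¹ * a p, -(exp (2 * L p))⁻¹ * b p,
          (exp (2 * M p))⁻¹ + (exp (2 * L p))⁻¹ * (a p ^ 2 + b p ^ 2)] := by
  apply Matrix.inv_eq_right_inv
  have hE := (exp_pos (2 * L p)).ne'
  have hF := (exp_pos (2 * M p)).ne'
  ext i j
  fin_cases i <;> fin_cases j <;>
    simp [killingMetric, Matrix.mul_apply, Fin.sum_univ_three] <;> field_simp <;> ring

/-- The Christoffel symbols `Γᵏᵢⱼ` of `killingMetric L M a b`, in terms of
`W = e^{2M - 2L}`, the first derivatives of `L`, `M`, `a`, `b`, and `c = ∂_z a - ∂_ρ b`. -/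
def killingChristoffel (L M a b c : ℝ × ℝ → ℝ) (k i j : Fin 3) (p : ℝ × ℝ) : ℝ :=
  ![![![pr L p - exp (2 * M p - 2 * L p) * (pr M p * (a p * a p)),
        pz L p + exp (2 * M p - 2 * L p) * (1 / 2 * (a p * c p) - pr M p * (a p * b p)),
        -exp (2 * M p - 2 * L p) * (pr M p * a p)],
      ![pz L p + exp (2 * M p - 2 * L p) * (1 / 2 * (a p * c p) - pr M p * (a p * b p)),
        -pr L p + exp (2 * M p - 2 * L p) * (b p * c p - pr M p * (b p * b p)),
        exp (2 * M p - 2 * L p) * (1 / 2 * c p - pr M p * b p)],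
      ![-exp (2 * M p - 2 * L p) * (pr M p * a p),
        exp (2 * M p - 2 * L p) * (1 / 2 * c p - pr M p * b p),
        -exp (2 * M p - 2 * L p) * pr M p]],
    ![![-pz L p - exp (2 * M p - 2 * L p) * (a p * c p + pz M p * (a p * a p)),
        pr L p - exp (2 * M p - 2 * L p) * (1 / 2 * (b p * c p) + pz M p * (a p * b p)),
        -exp (2 * M p - 2 * L p) * (1 / 2 * c p + pz M p * a p)],
      ![pr L p - exp (2 * M p - 2 * L p) * (1 / 2 * (b p * c p) + pz M p * (a p * b p)),
        pz L p - exp (2 * M p - 2 * L p) * (pz M p * (b p * b p)),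
        -exp (2 * M p - 2 * L p) * (pz M p * b p)],
      ![-exp (2 * M p - 2 * L p) * (1 / 2 * c p + pz M p * a p),
        -exp (2 * M p - 2 * L p) * (pz M p * b p),
        -exp (2 * M p - 2 * L p) * pz M p]],
    ![![-(a p * pr L p) + b p * pz L p + 2 * (pr M p * a p) + pr a p
          + exp (2 * M p - 2 * L p) *
            ((a p * pr M p + b p * pz M p) * (a p * a p) + a p * b p * c p),
        -(a p * pz L p) - b p * pr L p + pr M p * b p + pz M p * a p + 1 / 2 * (pr b p + pz a p)
          + exp (2 * M p - 2 * L p) *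
            ((a p * pr M p + b p * pz M p) * (a p * b p) - 1 / 2 * ((a p * a p - b p * b p) * c p)),
        pr M p + exp (2 * M p - 2 * L p) *
          ((a p * pr M p + b p * pz M p) * a p + 1 / 2 * (b p * c p))],
      ![-(a p * pz L p) - b p * pr L p + pr M p * b p + pz M p * a p + 1 / 2 * (pr b p + pz a p)
          + exp (2 * M p - 2 * L p) *
            ((a p * pr M p + b p * pz M p) * (a p * b p) - 1 / 2 * ((a p * a p - b p * b p) * c p)),
        a p * pr L p - b p * pz L p + 2 * (pz M p * b p) + pz b p
          + exp (2 * M p - 2 * L p) *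
            ((a p * pr M p + b p * pz M p) * (b p * b p) - a p * b p * c p),
        pz M p + exp (2 * M p - 2 * L p) *
          ((a p * pr M p + b p * pz M p) * b p - 1 / 2 * (a p * c p))],
      ![pr M p + exp (2 * M p - 2 * L p) *
          ((a p * pr M p + b p * pz M p) * a p + 1 / 2 * (b p * c p)),
        pz M p + exp (2 * M p - 2 * L p) *
          ((a p * pr M p + b p * pz M p) * b p - 1 / 2 * (a p * c p)),
        exp (2 * M p - 2 * L p) * (a p * pr M p + b p * pz M p)]]] k i j

/-- The derivative of `killingMetric L M a b` along a direction in which `L`, `M`, `a`, `b`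
have derivatives `l`, `m`, `u`, `v`. -/
def killingMetricDeriv (L M a b : ℝ × ℝ → ℝ) (p : ℝ × ℝ) (l m u v : ℝ) :
    Matrix (Fin 3) (Fin 3) ℝ :=
  !![exp (2 * L p) * (2 * l) + exp (2 * M p) * (2 * m * a p ^ 2 + 2 * a p * u),
      exp (2 * M p) * (2 * m * a p * b p + a p * v + b p * u),
      exp (2 * M p) * (2 * m * a p + u);
     exp (2 * M p) * (2 * m * a p * b p + a p * v + b p * u),
      exp (2 * L p) * (2 * l) + exp (2 * M p) * (2 * m * b p ^ 2 + 2 * b p * v),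
      exp (2 * M p) * (2 * m * b p + v);
     exp (2 * M p) * (2 * m * a p + u), exp (2 * M p) * (2 * m * b p + v),
      exp (2 * M p) * (2 * m)]

section

variable {L M a b : ℝ × ℝ → ℝ} {p : ℝ × ℝ}

theorem differentiableAt_killingMetric
    (hL : DifferentiableAt ℝ L p) (hM : DifferentiableAt ℝ M p)
    (ha : DifferentiableAt ℝ a p) (hb : DifferentiableAt ℝ b p) (i j : Fin 3) :
    DifferentiableAt ℝ (fun q => killingMetric L M a b q i j) p := by
  fin_cases i <;> fin_cases j <;> simp [killingMetric] <;> fun_prop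

theorem pr_killingMetric (hL : DifferentiableAt ℝ L p) (hM : DifferentiableAt ℝ M p)
    (ha : DifferentiableAt ℝ a p) (hb : DifferentiableAt ℝ b p) (i j : Fin 3) :
    pr (fun q => killingMetric L M a b q i j) p =
      killingMetricDeriv L M a b p (pr L p) (pr M p) (pr a p) (pr b p) i j := by
  fin_cases i <;> fin_cases j <;>
    simp (disch := fun_prop (disch := assumption))
      [killingMetric, killingMetricDeriv, pr_add, pr_mul, pr_exp, pr_const] <;> ring

theorem pz_killingMetric (hL : DifferentiableAt ℝ L p) (hM : DifferentiableAt ℝ M p)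
    (ha : DifferentiableAt ℝ a p) (hb : DifferentiableAt ℝ b p) (i j : Fin 3) :
    pz (fun q => killingMetric L M a b q i j) p =
      killingMetricDeriv L M a b p (pz L p) (pz M p) (pz a p) (pz b p) i j := by
  fin_cases i <;> fin_cases j <;>
    simp (disch := fun_prop (disch := assumption))
      [killingMetric, killingMetricDeriv, pz_add, pz_mul, pz_exp, pz_const] <;> ring

end

set_option maxHeartbeats 1600000 in
theorem christoffel_killingMetric {L M a b : ℝ × ℝ → ℝ} {x : Fin 3 → ℝ}
    (hL : DifferentiableAt ℝ L (x 0, x 1)) (hM : DifferentiableAt ℝ M (x 0, x 1))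
    (ha : DifferentiableAt ℝ a (x 0, x 1)) (hb : DifferentiableAt ℝ b (x 0, x 1))
    (k i j : Fin 3) :
    christoffel (fun y => killingMetric L M a b (y 0, y 1)) k i j x =
      killingChristoffel L M a b (fun q => pz a q - pr b q) k i j (x 0, x 1) := by
  have h0 (i j : Fin 3) : pd3 0 (fun y => killingMetric L M a b (y 0, y 1) i j) x = _ :=
    (pd3_zero_orbit (differentiableAt_killingMetric hL hM ha hb i j)).trans
      (pr_killingMetric hL hM ha hb i j)
  have h1 (i j : Fin 3) : pd3 1 (fun y => killingMetric L M a b (y 0, y 1) i j) x = _ :=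
    (pd3_one_orbit (differentiableAt_killingMetric hL hM ha hb i j)).trans
      (pz_killingMetric hL hM ha hb i j)
  have h2 (i j : Fin 3) : pd3 2 (fun y => killingMetric L M a b (y 0, y 1) i j) x = 0 :=
    pd3_two_orbit (fun p => killingMetric L M a b p i j) x
  simp only [christoffel, Fin.sum_univ_three, killingMetric_inv]
  have hE := (exp_pos (2 * L (x 0, x 1))).ne'
  have hF := (exp_pos (2 * M (x 0, x 1))).ne'
  fin_cases k <;> fin_cases i <;> fin_cases j <;>
    simp [h0, h1, h2, killingMetricDeriv, killingChristoffel, exp_sub] <;> field_simp <;> ring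

set_option maxHeartbeats 4000000 in
theorem scalarCurv_killingMetric {L M a b : ℝ × ℝ → ℝ} {s : Set (ℝ × ℝ)} (hs : IsOpen s)
    (hL : ∀ p ∈ s, ContDiffAt ℝ 2 L p) (hM : ∀ p ∈ s, ContDiffAt ℝ 2 M p)
    (ha : ∀ p ∈ s, ContDiffAt ℝ 2 a p) (hb : ∀ p ∈ s, ContDiffAt ℝ 2 b p)
    {x : Fin 3 → ℝ} (hx : (x 0, x 1) ∈ s) :
    scalarCurv (fun y => killingMetric L M a b (y 0, y 1)) x =
      -2 * exp (-2 * L (x 0, x 1)) * (lapRZ L (x 0, x 1) + lapRZ M (x 0, x 1)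
          + pr M (x 0, x 1) ^ 2 + pz M (x 0, x 1) ^ 2)
        - 1 / 2 * exp (2 * M (x 0, x 1) - 4 * L (x 0, x 1))
          * (pz a (x 0, x 1) - pr b (x 0, x 1)) ^ 2 := by
  have hs3 : {y : Fin 3 → ℝ | (y 0, y 1) ∈ s} ∈ 𝓝 x :=
    (hs.preimage (by fun_prop : Continuous fun y : Fin 3 → ℝ => (y 0, y 1))).mem_nhds hx
  have hc : ∀ y : Fin 3 → ℝ, (y 0, y 1) ∈ s → ∀ k i j,
      christoffel (fun y => killingMetric L M a b (y 0, y 1)) k i j y =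
        killingChristoffel L M a b (fun q => pz a q - pr b q) k i j (y 0, y 1) :=
    fun y hy => christoffel_killingMetric ((hL _ hy).differentiableAt two_ne_zero)
      ((hM _ hy).differentiableAt two_ne_zero) ((ha _ hy).differentiableAt two_ne_zero)
      ((hb _ hy).differentiableAt two_ne_zero)
  have hpc (l k i j : Fin 3) :
      pd3 l (christoffel (fun y => killingMetric L M a b (y 0, y 1)) k i j) x =
        pd3 l (fun y => killingChristoffel L M a b (fun q => pz a q - pr b q) k i j (y 0, y 1)) x :=
    pd3_congr l (mem_of_superset hs3 fun y hy => hc y hy k i j)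
  have dL := (hL _ hx).differentiableAt two_ne_zero
  have dM := (hM _ hx).differentiableAt two_ne_zero
  have da := (ha _ hx).differentiableAt two_ne_zero
  have db := (hb _ hx).differentiableAt two_ne_zero
  have dLr := differentiableAt_pr (hL _ hx)
  have dLz := differentiableAt_pz (hL _ hx)
  have dMr := differentiableAt_pr (hM _ hx)
  have dMz := differentiableAt_pz (hM _ hx)
  have dar := differentiableAt_pr (ha _ hx)
  have daz := differentiableAt_pz (ha _ hx)
  have dbr := differentiableAt_pr (hb _ hx)
  have dbz := differentiableAt_pz (hb _ hx)
  simp only [scalarCurv, ricci, hpc, hc x hx, killingMetric_inv]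
  have dc : DifferentiableAt ℝ (fun q => pz a q - pr b q) (x 0, x 1) := daz.sub dbr
  have hcval : (fun q => pz a q - pr b q) (x 0, x 1) = pz a (x 0, x 1) - pr b (x 0, x 1) := rfl
  rw [← hcval]
  generalize hcdef : (fun q => pz a q - pr b q) = c at *
  have hd (k i j : Fin 3) :
      DifferentiableAt ℝ (killingChristoffel L M a b c k i j) (x 0, x 1) := by
    unfold killingChristoffel
    fin_cases k <;> fin_cases i <;> fin_cases j <;> simp <;> fun_prop (disch := assumption)
  have h0 (k i j : Fin 3) :
      pd3 0 (fun y => killingChristoffel L M a b c k i j (y 0, y 1)) x =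
        pr (killingChristoffel L M a b c k i j) (x 0, x 1) := pd3_zero_orbit (hd k i j)
  have h1 (k i j : Fin 3) :
      pd3 1 (fun y => killingChristoffel L M a b c k i j (y 0, y 1)) x =
        pz (killingChristoffel L M a b c k i j) (x 0, x 1) := pd3_one_orbit (hd k i j)
  have h2 (k i j : Fin 3) :
      pd3 2 (fun y => killingChristoffel L M a b c k i j (y 0, y 1)) x = 0 :=
    pd3_two_orbit (killingChristoffel L M a b c k i j) x
  simp only [Fin.sum_univ_three, h0, h1, h2]
  generalize (x 0, x 1) = p at *
  have hW : exp (2 * M p - 4 * L p) = exp (2 * M p) * ((exp (2 * L p))⁻¹ * (exp (2 * L p))⁻¹) := by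
    rw [← exp_neg, ← exp_add, ← exp_add]; ring_nf
  have hE := (exp_pos (2 * L p)).ne'
  have hF := (exp_pos (2 * M p)).ne'
  unfold killingChristoffel
  simp (disch := fun_prop (disch := assumption)) [pr_add, pz_add, pr_sub, pz_sub, pr_mul, pz_mul,
    pr_neg, pz_neg, pr_exp, pz_exp, pr_const, pz_const]
  simp only [lapRZ, exp_sub, exp_neg, hW]
  field_simp
  simp only [hcval]
  ring

theorem lap_norm_killing (U α Ar Az : ℝ × ℝ → ℝ)
    (hU : ContDiff ℝ (⊤ : ℕ∞) U) (hα : ContDiff ℝ (⊤ : ℕ∞) α)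
    (hAr : ContDiff ℝ (⊤ : ℕ∞) Ar) (hAz : ContDiff ℝ (⊤ : ℕ∞) Az)
    (x : Fin 3 → ℝ) (hρ : 0 < x 0) :
    -- Δ̂|η| = |η|(K − R/2) − (1/4)|η|³ e^{4(U−α)}(∂_z A_ρ − ∂_ρ A_z)²
    lapConf (fun q => α q - U q) (fun q => q.1 * exp (-U q)) (x 0, x 1) =
      (x 0 * exp (-U (x 0, x 1))) *
          (gaussConf (fun q => α q - U q) (x 0, x 1)
            - scalarCurv (brillMetric U α Ar Az) x / 2)
        - (1 / 4) * (x 0 * exp (-U (x 0, x 1))) ^ 3 *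
            exp (4 * (U (x 0, x 1) - α (x 0, x 1))) *
            (pz Ar (x 0, x 1) - pr Az (x 0, x 1)) ^ 2 := by
  set L : ℝ × ℝ → ℝ := fun q => α q - U q with hLdef
  set M : ℝ × ℝ → ℝ := fun q => log q.1 - U q with hMdef
  set s : Set (ℝ × ℝ) := {q | 0 < q.1}
  have hs : IsOpen s := isOpen_lt continuous_const continuous_fst
  have hx : (x 0, x 1) ∈ s := hρ
  have two {f : ℝ × ℝ → ℝ} (hf : ContDiff ℝ (⊤ : ℕ∞) f) (q : ℝ × ℝ) : ContDiffAt ℝ 2 f q :=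
    (hf.of_le (WithTop.coe_le_coe.2 le_top)).contDiffAt
  have hL : ∀ q ∈ s, ContDiffAt ℝ 2 L q := fun q _ => (two hα q).sub (two hU q)
  have hM : ∀ q ∈ s, ContDiffAt ℝ 2 M q := fun q hq =>
    (contDiffAt_fst.log (ne_of_gt hq)).sub (two hU q)
  have hexp : ∀ q ∈ s, exp (M q) = q.1 * exp (-U q) := fun q hq => by
    simp only [hMdef, sub_eq_add_neg, exp_add, exp_log (show 0 < q.1 from hq)]
  have hlap : lapRZ (fun q => q.1 * exp (-U q)) (x 0, x 1) = lapRZ (fun q => exp (M q)) (x 0, x 1) :=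
    lapRZ_congr (mem_of_superset (hs.mem_nhds hx) fun q hq => (hexp q hq).symm)
  have hmetric : ∀ y : Fin 3 → ℝ, (y 0, y 1) ∈ s →
      brillMetric U α Ar Az y = killingMetric L M Ar Az (y 0, y 1) := fun y hy => by
    have e1 : exp (2 * L (y 0, y 1)) = exp (-2 * U (y 0, y 1) + 2 * α (y 0, y 1)) := by
      congr 1; simp only [hLdef]; ring
    have e2 : exp (2 * M (y 0, y 1)) = y 0 ^ 2 * exp (-2 * U (y 0, y 1)) := by
      rw [two_mul, exp_add, hexp _ hy, show -2 * U (y 0, y 1) = -U (y 0, y 1) + -U (y 0, y 1) by ring,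
        exp_add]
      ring
    simp only [brillMetric, killingMetric, e1, e2]
    ext i j
    fin_cases i <;> fin_cases j <;> simp <;> ring_nf <;> simp
  have hscal := scalarCurv_congr (x := x) (mem_of_superset
    ((hs.preimage (by fun_prop : Continuous fun y : Fin 3 → ℝ => (y 0, y 1))).mem_nhds hx) hmetric)
  rw [hscal, scalarCurv_killingMetric hs hL hM (fun q _ => two hAr q) (fun q _ => two hAz q) hx,
    ← hexp _ hx, lapConf, gaussConf, hlap, lapRZ_exp hs hM hx,
    show 4 * (U (x 0, x 1) - α (x 0, x 1)) = -(4 * L (x 0, x 1)) by simp only [hLdef]; ring,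
    show 2 * M (x 0, x 1) - 4 * L (x 0, x 1) =
      M (x 0, x 1) + M (x 0, x 1) + -(4 * L (x 0, x 1)) by ring, exp_add, exp_add]
  ring

end
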